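/- Let $n \ge 1$ and let $c \in \mathbb{R}^n$ satisfy $0 < |c| < \sqrt{2}$. Let $f : \mathbb{R} \to \mathbb{R}$ satisfy: (A1) $\liminf_{u \to -\infty} \bigl(f(u) + u\bigr) > -\infty$; and (A2) there exist constants $C_1 > 0$, $p \ge 1$, $q > 1$ such that $|f(u) - f(v)| \le C_1(|u| + |v|)^{p-1}|u - v|$ and $|f(u)| \le C_1 |u|^q$ for all $u, v \in \mathbb{R}$. Then there exists a Schwartz function $u : \mathbb{R}^n \to \mathbb{R}$, not identically zero, such that $P_c(u) = 0$, where $$P_c(u) = \int_{\mathbb{R}^n} (\Delta u)^2 - (c\cdot\nabla u)^2 + u^2 \,dx + \int_{\mathbb{R}^n} u\,f(u) \,dx.$$ -/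

import Mathlib

open MeasureTheory

/-- The Laplacian of `u : ℝⁿ → ℝ` at a point, as the sum of second partial derivatives. -/
noncomputable def laplacian {n : ℕ} (u : EuclideanSpace ℝ (Fin n) → ℝ)
    (x : EuclideanSpace ℝ (Fin n)) : ℝ :=
  ∑ i : Fin n,
    fderiv ℝ (fun y => fderiv ℝ u y (EuclideanSpace.single i 1)) x (EuclideanSpace.single i 1)

/-- The directional derivative `c ⋅ ∇u` at a point. -/
noncomputable def cGrad {n : ℕ} (c : EuclideanSpace ℝ (Fin n))
    (u : EuclideanSpace ℝ (Fin n) → ℝ) (x : EuclideanSpace ℝ (Fin n)) : ℝ :=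
  ∑ i : Fin n, c i * fderiv ℝ u x (EuclideanSpace.single i 1)

/-- The Nehari functional `P_c`. -/
noncomputable def Pc {n : ℕ} (c : EuclideanSpace ℝ (Fin n)) (f : ℝ → ℝ)
    (u : EuclideanSpace ℝ (Fin n) → ℝ) : ℝ :=
  (∫ x, ((laplacian u x) ^ 2 - (cGrad c u x) ^ 2 + (u x) ^ 2)) + ∫ x, u x * f (u x)

section helpers

variable {n : ℕ}

lemma fderiv_scale {φ : EuclideanSpace ℝ (Fin n) → ℝ} (hφ : Differentiable ℝ φ) (a l : ℝ)
    (x v : EuclideanSpace ℝ (Fin n)) :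
    fderiv ℝ (fun y => a * φ (l • y)) x v = (a * l) * fderiv ℝ φ (l • x) v := by
  have h1 : DifferentiableAt ℝ (fun y : EuclideanSpace ℝ (Fin n) => φ (l • y)) x := by fun_prop
  rw [fderiv_const_mul h1, fderiv_comp_smul]
  simp [mul_assoc]

lemma diff_partial {φ : EuclideanSpace ℝ (Fin n) → ℝ} (hφ : ContDiff ℝ 2 φ)
    (v : EuclideanSpace ℝ (Fin n)) : ContDiff ℝ 1 (fun y => fderiv ℝ φ y v) :=
  (hφ.fderiv_right (m := 1) (by norm_num)).clm_apply contDiff_const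

lemma cGrad_scale (c : EuclideanSpace ℝ (Fin n)) {φ : EuclideanSpace ℝ (Fin n) → ℝ}
    (hφ : ContDiff ℝ 2 φ) (a l : ℝ) (x : EuclideanSpace ℝ (Fin n)) :
    cGrad c (fun y => a * φ (l • y)) x = a * l * cGrad c φ (l • x) := by
  unfold cGrad
  rw [Finset.mul_sum]
  refine Finset.sum_congr rfl fun i _ => ?_
  rw [fderiv_scale (hφ.differentiable (by norm_num))]
  ring

lemma laplacian_scale {φ : EuclideanSpace ℝ (Fin n) → ℝ}
    (hφ : ContDiff ℝ 2 φ) (a l : ℝ) (x : EuclideanSpace ℝ (Fin n)) :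
    laplacian (fun y => a * φ (l • y)) x = a * l ^ 2 * laplacian φ (l • x) := by
  unfold laplacian
  rw [Finset.mul_sum]
  refine Finset.sum_congr rfl fun i _ => ?_
  have h : (fun y => fderiv ℝ (fun y => a * φ (l • y)) y (EuclideanSpace.single i 1))
      = fun y => (a * l) * (fun z => fderiv ℝ φ z (EuclideanSpace.single i 1)) (l • y) := by
    funext y
    exact fderiv_scale (hφ.differentiable (by norm_num)) a l y _
  rw [h, fderiv_scale ((diff_partial hφ _).differentiable (by norm_num))]
  ring

lemma cGrad_eq (c : EuclideanSpace ℝ (Fin n)) (φ : EuclideanSpace ℝ (Fin n) → ℝ)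
    (x : EuclideanSpace ℝ (Fin n)) : cGrad c φ x = fderiv ℝ φ x c := by
  have hc : c = ∑ i, c i • EuclideanSpace.single i (1 : ℝ) := by
    ext j
    simp [Finset.sum_apply, Pi.single_apply]
  conv_rhs => rw [hc]
  simp [cGrad, map_sum]

lemma cGrad_cont (c : EuclideanSpace ℝ (Fin n)) {φ : EuclideanSpace ℝ (Fin n) → ℝ}
    (hφ : ContDiff ℝ 2 φ) : Continuous (cGrad c φ) := by
  have : cGrad c φ = fun x => fderiv ℝ φ x c := funext (cGrad_eq c φ)
  rw [this]
  exact (diff_partial hφ c).continuous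

lemma cGrad_supp (c : EuclideanSpace ℝ (Fin n)) {φ : EuclideanSpace ℝ (Fin n) → ℝ}
    (hφ : HasCompactSupport φ) : HasCompactSupport (cGrad c φ) := by
  have : cGrad c φ = fun x => fderiv ℝ φ x c := funext (cGrad_eq c φ)
  rw [this]
  exact hφ.fderiv_apply ℝ c

lemma laplacian_cont {φ : EuclideanSpace ℝ (Fin n) → ℝ}
    (hφ : ContDiff ℝ 2 φ) : Continuous (laplacian φ) := by
  unfold laplacian
  refine continuous_finsetSum _ fun i _ => ?_
  exact (((diff_partial hφ _).fderiv_right (m := 0) (by norm_num)).clm_apply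
    contDiff_const).continuous

lemma laplacian_supp {φ : EuclideanSpace ℝ (Fin n) → ℝ}
    (hφ : HasCompactSupport φ) : HasCompactSupport (laplacian φ) := by
  refine HasCompactSupport.intro hφ.isCompact (fun x hx => ?_)
  unfold laplacian
  refine Finset.sum_eq_zero fun i _ => ?_
  refine image_eq_zero_of_notMem_tsupport (f := fun x => fderiv ℝ
    (fun y => fderiv ℝ φ y (EuclideanSpace.single i 1)) x (EuclideanSpace.single i 1)) ?_
  exact fun h => hx (tsupport_fderiv_apply_subset ℝ _ (tsupport_fderiv_apply_subset ℝ _ h))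

lemma sq_supp {g : EuclideanSpace ℝ (Fin n) → ℝ}
    (hs : HasCompactSupport g) : HasCompactSupport (fun x => g x ^ 2) := by
  refine HasCompactSupport.intro hs.isCompact (fun x hx => ?_)
  rw [image_eq_zero_of_notMem_tsupport hx]
  norm_num

lemma sq_cont {g : EuclideanSpace ℝ (Fin n) → ℝ} (hg : Continuous g) :
    Continuous (fun x => g x ^ 2) := by fun_prop

lemma sq_integrable {g : EuclideanSpace ℝ (Fin n) → ℝ} (hg : Continuous g)
    (hs : HasCompactSupport g) : Integrable (fun x => g x ^ 2) :=
  (sq_cont hg).integrable_of_hasCompactSupport (sq_supp hs)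

lemma sq_int_pos {g : EuclideanSpace ℝ (Fin n) → ℝ} (hg : Continuous g)
    (hs : HasCompactSupport g) (x : EuclideanSpace ℝ (Fin n)) (hx : g x ≠ 0) :
    0 < ∫ x, g x ^ 2 :=
  (sq_cont hg).integral_pos_of_hasCompactSupport_nonneg_nonzero (sq_supp hs)
    (fun x => sq_nonneg (g x)) (x := x) (pow_ne_zero 2 hx)

set_option maxHeartbeats 1000000 in
lemma Pc_scale (c : EuclideanSpace ℝ (Fin n)) (f : ℝ → ℝ) {φ : EuclideanSpace ℝ (Fin n) → ℝ}
    (hφ : ContDiff ℝ 2 φ) (hs : HasCompactSupport φ) (t l : ℝ) :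
    Pc c f (fun y => (-t) * φ (l • y)) = |(l ^ n)⁻¹| *
      (t ^ 2 * (l ^ 4 * (∫ x, laplacian φ x ^ 2) - l ^ 2 * (∫ x, cGrad c φ x ^ 2) + ∫ x, φ x ^ 2)
        + ∫ x, (-t * φ x) * f (-t * φ x)) := by
  have i1 : Integrable (fun x => laplacian φ x ^ 2) :=
    sq_integrable (laplacian_cont hφ) (laplacian_supp hs)
  have i2 : Integrable (fun x => cGrad c φ x ^ 2) :=
    sq_integrable (cGrad_cont c hφ) (cGrad_supp c hs)
  have i3 : Integrable (fun x => φ x ^ 2) :=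
    sq_integrable hφ.continuous hs
  have e1 := Measure.integral_comp_smul (volume : Measure (EuclideanSpace ℝ (Fin n)))
    (fun x => t ^ 2 * (l ^ 4 * laplacian φ x ^ 2 - l ^ 2 * cGrad c φ x ^ 2 + φ x ^ 2)) l
  have e2 := Measure.integral_comp_smul (volume : Measure (EuclideanSpace ℝ (Fin n)))
    (fun x => (-t * φ x) * f (-t * φ x)) l
  have e3 : ∫ x, t ^ 2 * (l ^ 4 * laplacian φ x ^ 2 - l ^ 2 * cGrad c φ x ^ 2 + φ x ^ 2)
      = t ^ 2 * (l ^ 4 * (∫ x, laplacian φ x ^ 2) - l ^ 2 * (∫ x, cGrad c φ x ^ 2)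
        + ∫ x, φ x ^ 2) := by
    have i4 : Integrable (fun x => l ^ 4 * laplacian φ x ^ 2 - l ^ 2 * cGrad c φ x ^ 2) :=
      (i1.const_mul _).sub (i2.const_mul _)
    rw [integral_const_mul, integral_add i4 i3,
      integral_sub (i1.const_mul _) (i2.const_mul _), integral_const_mul, integral_const_mul]
  rw [e3] at e1
  simp only [smul_eq_mul, finrank_euclideanSpace, Fintype.card_fin] at e1 e2
  unfold Pc
  rw [mul_add, ← e1, ← e2]
  congr 1
  refine integral_congr_ae (Filter.Eventually.of_forall fun x => ?_)
  simp only [laplacian_scale hφ, cGrad_scale c hφ]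
  ring

/-- Lower bound for `f` on the negative half-line. -/
lemma f_lower (f : ℝ → ℝ)
    (hA1 : ⊥ < Filter.liminf (fun u : ℝ => ((f u + u : ℝ) : EReal)) Filter.atBot)
    (C q : ℝ) (hC : 0 < C) (hq : 1 < q) (hf : ∀ u : ℝ, |f u| ≤ C * |u| ^ q) :
    ∃ M : ℝ, ∀ s : ℝ, 0 ≤ s → s - M ≤ f (-s) := by
  obtain ⟨m, hm1, hm2⟩ := EReal.lt_iff_exists_real_btwn.1 hA1
  have h := Filter.eventually_lt_of_lt_liminf hm2
  obtain ⟨N, hN⟩ := Filter.eventually_atBot.1 h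
  refine ⟨max (-m) (|N| + C * |N| ^ q), fun s hs => ?_⟩
  rcases le_total (-s) N with h1 | h1
  · have := EReal.coe_lt_coe_iff.1 (hN _ h1)
    have h2 := le_max_left (-m) (|N| + C * |N| ^ q)
    linarith
  · have h2 := le_max_right (-m) (|N| + C * |N| ^ q)
    have h3 : s ≤ |N| := by
      have := neg_le_abs N
      linarith
    have h4 := (abs_le.1 (hf (-s))).1
    rw [abs_neg, abs_of_nonneg hs] at h4
    have h5 : C * s ^ q ≤ C * |N| ^ q :=
      mul_le_mul_of_nonneg_left (Real.rpow_le_rpow hs h3 (by linarith)) hC.le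
    linarith

lemma f_cont (f : ℝ → ℝ) (C p : ℝ) (hp : 1 ≤ p)
    (hf : ∀ u v : ℝ, |f u - f v| ≤ C * (|u| + |v|) ^ (p - 1) * |u - v|) : Continuous f := by
  rw [continuous_iff_continuousAt]
  intro v
  rw [ContinuousAt, tendsto_iff_dist_tendsto_zero]
  have hc : Continuous fun u : ℝ => C * (|u| + |v|) ^ (p - 1) * |u - v| := by
    refine (continuous_const.mul (Continuous.rpow_const (by fun_prop) ?_)).mul (by fun_prop)
    intro x
    right
    linarith
  have := hc.tendsto v
  simp only [sub_self, abs_zero, mul_zero] at this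
  exact squeeze_zero (fun _ => dist_nonneg) (fun u => by rw [Real.dist_eq]; exact hf u v) this

end helpers

set_option maxHeartbeats 2000000 in
theorem stmt_4 (n : ℕ) (hn : 1 ≤ n) (c : EuclideanSpace ℝ (Fin n))
    (hc0 : 0 < ‖c‖) (hc2 : ‖c‖ < Real.sqrt 2) (f : ℝ → ℝ)
    (hA1 : ⊥ < Filter.liminf (fun u : ℝ => ((f u + u : ℝ) : EReal)) Filter.atBot)
    (hA2 : ∃ C₁ : ℝ, 0 < C₁ ∧ ∃ p : ℝ, 1 ≤ p ∧ ∃ q : ℝ, 1 < q ∧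
      (∀ u v : ℝ, |f u - f v| ≤ C₁ * (|u| + |v|) ^ (p - 1) * |u - v|) ∧
      (∀ u : ℝ, |f u| ≤ C₁ * |u| ^ q)) :
    ∃ u : SchwartzMap (EuclideanSpace ℝ (Fin n)) ℝ, u ≠ 0 ∧ Pc c f (fun x => u x) = 0 := by
  obtain ⟨C, hC, p, hp, q, hq, hL, hG⟩ := hA2
  have hfc := f_cont f C p hp hL
  have hf0 : f 0 = 0 := by
    have := hG 0
    rw [abs_zero, Real.zero_rpow (by linarith), mul_zero] at this
    exact abs_nonpos_iff.1 this
  obtain ⟨M, hM⟩ := f_lower f hA1 C q hC hq hG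
  let φ : ContDiffBump (0 : EuclideanSpace ℝ (Fin n)) := ⟨1, 2, one_pos, one_lt_two⟩
  have hφ2 : ContDiff ℝ 2 φ := φ.contDiff
  have hφs : HasCompactSupport φ := φ.hasCompactSupport
  have hφ0 : φ 0 = 1 := φ.one_of_mem_closedBall (by simp [φ])
  have i1 : Integrable (fun x => φ x) := φ.continuous.integrable_of_hasCompactSupport hφs
  have i3 : Integrable (fun x => φ x ^ 2) :=
    sq_integrable φ.continuous hφs
  have iG : ∀ t : ℝ, Integrable (fun x => (-t * φ x) * f (-t * φ x)) := fun t =>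
    Continuous.integrable_of_hasCompactSupport
      ((continuous_const.mul φ.continuous).mul (hfc.comp (continuous_const.mul φ.continuous)))
      (hφs.comp_left (g := fun y : ℝ => (-t * y) * f (-t * y)) (by simp))
  -- the constants
  obtain ⟨A, hA⟩ : ∃ A, A = ∫ x, laplacian φ x ^ 2 := ⟨_, rfl⟩
  obtain ⟨B, hB⟩ : ∃ B, B = ∫ x, cGrad c φ x ^ 2 := ⟨_, rfl⟩
  obtain ⟨D, hD⟩ : ∃ D, D = ∫ x, φ x ^ 2 := ⟨_, rfl⟩
  obtain ⟨S, hS⟩ : ∃ S, S = ∫ x, φ x := ⟨_, rfl⟩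
  have hA0 : 0 ≤ A := hA ▸ integral_nonneg fun x => sq_nonneg _
  have hS0 : 0 ≤ S := hS ▸ integral_nonneg fun x => φ.nonneg
  have hD0 : 0 < D := by
    rw [hD]
    exact sq_int_pos φ.continuous hφs 0 (by simp [hφ0])
  have hB0 : 0 < B := by
    have hx : ∃ x, cGrad c φ x ≠ 0 := by
      by_contra! hcon
      have hd : ∀ t : ℝ, HasDerivAt (fun t : ℝ => φ (t • c)) 0 t := by
        intro t
        have h1 : HasDerivAt (fun t : ℝ => t • c) c t := by
          simpa using (hasDerivAt_id t).smul_const c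
        have h2 := (hφ2.differentiable (by norm_num) (t • c)).hasFDerivAt.comp_hasDerivAt t h1
        rw [← cGrad_eq, hcon] at h2
        exact h2
      have h3 := is_const_of_deriv_eq_zero (fun t => (hd t).differentiableAt)
        (fun t => (hd t).deriv) 0 (2 / ‖c‖)
      simp only [zero_smul, hφ0] at h3
      rw [φ.zero_of_le_dist] at h3
      · norm_num at h3
      · simp [φ, norm_smul, hc0.ne']
    obtain ⟨x, hx⟩ := hx
    rw [hB]
    exact sq_int_pos (cGrad_cont c hφ2) (cGrad_supp c hφs) x hx
  -- the scale
  obtain ⟨l, hl0, hl1, hl2⟩ : ∃ l : ℝ, 0 < l ∧ l ^ 2 * A < B ∧ l ^ 2 * B < D := by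
    have t1 : Filter.Tendsto (fun l : ℝ => l ^ 2 * A) (nhdsWithin 0 (Set.Ioi 0)) (nhds 0) := by
      have : Continuous fun l : ℝ => l ^ 2 * A := by fun_prop
      simpa using (this.tendsto 0).mono_left nhdsWithin_le_nhds
    have t2 : Filter.Tendsto (fun l : ℝ => l ^ 2 * B) (nhdsWithin 0 (Set.Ioi 0)) (nhds 0) := by
      have : Continuous fun l : ℝ => l ^ 2 * B := by fun_prop
      simpa using (this.tendsto 0).mono_left nhdsWithin_le_nhds
    obtain ⟨l, h1, h2, h3⟩ := ((t1.eventually_lt_const hB0).and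
      ((t2.eventually_lt_const hD0).and self_mem_nhdsWithin)).exists
    exact ⟨l, h3, h1, h2⟩
  obtain ⟨Q, hQ⟩ : ∃ Q, Q = l ^ 4 * A - l ^ 2 * B + D := ⟨_, rfl⟩
  have hQ0 : 0 < Q := by
    have : 0 ≤ l ^ 4 * A := by positivity
    linarith
  have hQD : 0 < D - Q := by
    have : 0 < l ^ 2 * (B - l ^ 2 * A) := mul_pos (by positivity) (by linarith)
    rw [hQ]
    linarith [this, (by ring : l ^ 2 * (B - l ^ 2 * A) = l ^ 2 * B - l ^ 4 * A)]
  let G : ℝ → ℝ := fun t => ∫ x, (-t * φ x) * f (-t * φ x)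
  have hGc : Continuous G := by
    rw [← continuousOn_univ]
    refine continuousOn_integral_of_compact_support (k := tsupport φ) hφs.isCompact ?_ ?_
    · refine Continuous.continuousOn ?_
      have h1 : Continuous fun z : ℝ × EuclideanSpace ℝ (Fin n) => -z.1 * φ z.2 :=
        continuous_fst.neg.mul (φ.continuous.comp continuous_snd)
      exact h1.mul (hfc.comp h1)
    · intro t x _ hx
      rw [image_eq_zero_of_notMem_tsupport hx]
      simp
  have hGup : ∀ t, 0 ≤ t → G t ≤ -t ^ 2 * D + M * t * S := by
    intro t ht
    have : -t ^ 2 * D + M * t * S = ∫ x, (-t ^ 2 * φ x ^ 2 + M * t * φ x) := by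
      rw [integral_add (i3.const_mul _) (i1.const_mul _), integral_const_mul,
        integral_const_mul, hD, hS]
    rw [this]
    refine integral_mono (iG t) ((i3.const_mul _).add (i1.const_mul _)) fun x => ?_
    have h0 : 0 ≤ t * φ x := mul_nonneg ht φ.nonneg
    have h1 := mul_le_mul_of_nonneg_left (hM _ h0) h0
    simp only [neg_mul]
    nlinarith
  have hGlo : ∀ t, 0 ≤ t → -(C * t ^ 2 * t ^ (q - 1) * S) ≤ G t := by
    intro t ht
    have : -(C * t ^ 2 * t ^ (q - 1) * S) = ∫ x, (-(C * t ^ 2 * t ^ (q - 1)) * φ x) := by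
      rw [integral_const_mul, hS]
      ring
    rw [this]
    refine integral_mono (i1.const_mul _) (iG t) fun x => ?_
    have h0 : 0 ≤ t * φ x := mul_nonneg ht φ.nonneg
    have h1 := (abs_le.1 (hG (-(t * φ x)))).2
    rw [abs_neg, abs_of_nonneg h0] at h1
    have h2 : (t * φ x) ^ q ≤ t * t ^ (q - 1) := by
      have e : t * t ^ (q - 1) = t ^ q := by
        conv_rhs => rw [show q = 1 + (q - 1) by ring,
          Real.rpow_add_of_nonneg ht zero_le_one (by linarith), Real.rpow_one]
      rw [e]
      exact Real.rpow_le_rpow h0 (mul_le_of_le_one_right ht φ.le_one) (by linarith)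
    have h3 : f (-(t * φ x)) ≤ C * (t * t ^ (q - 1)) :=
      h1.trans (mul_le_mul_of_nonneg_left h2 hC.le)
    have h4 := mul_le_mul_of_nonneg_left h3 h0
    simp only [neg_mul]
    nlinarith
  let H : ℝ → ℝ := fun t => t ^ 2 * Q + G t
  have hHc : Continuous H := by fun_prop
  obtain ⟨a, ha, hHa⟩ : ∃ a, 0 < a ∧ 0 ≤ H a := by
    have t1 : Filter.Tendsto (fun t : ℝ => C * t ^ (q - 1) * S)
        (nhdsWithin 0 (Set.Ioi 0)) (nhds 0) := by
      have : Continuous fun t : ℝ => C * t ^ (q - 1) * S := by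
        refine (continuous_const.mul (Continuous.rpow_const continuous_id ?_)).mul continuous_const
        intro x
        right
        linarith
      have h := (this.tendsto 0).mono_left (nhdsWithin_le_nhds (s := Set.Ioi 0))
      rwa [Real.zero_rpow (by linarith), mul_zero, zero_mul] at h
    obtain ⟨t, h1, h2⟩ := ((t1.eventually_lt_const hQ0).and self_mem_nhdsWithin).exists
    have h2 : 0 < t := h2
    refine ⟨t, h2, ?_⟩
    have h3 := hGlo t h2.le
    have h4 : 0 ≤ t ^ 2 * (Q - C * t ^ (q - 1) * S) := mul_nonneg (sq_nonneg _) (by linarith)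
    simp only [H]
    linarith [h4, (by ring : t ^ 2 * (Q - C * t ^ (q - 1) * S)
      = t ^ 2 * Q - C * t ^ 2 * t ^ (q - 1) * S)]
  obtain ⟨b, hab, hHb⟩ : ∃ b, a ≤ b ∧ H b ≤ 0 := by
    refine ⟨max a (M * S / (D - Q)), le_max_left _ _, ?_⟩
    have h1 : M * S / (D - Q) ≤ max a (M * S / (D - Q)) := le_max_right _ _
    have h2 : 0 ≤ max a (M * S / (D - Q)) := ha.le.trans (le_max_left _ _)
    generalize max a (M * S / (D - Q)) = b at h1 h2
    rw [div_le_iff₀ hQD] at h1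
    have h3 := hGup b h2
    have h4 := mul_le_mul_of_nonneg_left h1 h2
    simp only [H]
    nlinarith
  obtain ⟨t, ⟨hta, -⟩, ht⟩ := intermediate_value_Icc' hab hHc.continuousOn ⟨hHb, hHa⟩
  have ht0 : 0 < t := ha.trans_le hta
  have hsm : ContDiff ℝ (⊤ : ℕ∞) (fun x => (-t) * φ (l • x)) :=
    contDiff_const.mul (φ.contDiff.comp (contDiff_const_smul l))
  have hcs : HasCompactSupport (fun x => (-t) * φ (l • x)) :=
    (hφs.comp_smul hl0.ne').mul_left
  refine ⟨hcs.toSchwartzMap hsm, ?_, ?_⟩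
  · intro h
    have h1 := congrArg (fun g : SchwartzMap (EuclideanSpace ℝ (Fin n)) ℝ => g 0) h
    simp [hφ0] at h1
    exact ht0.ne' h1
  · have h1 := Pc_scale c f hφ2 hφs t l
    rw [← hA, ← hB, ← hD, ← hQ] at h1
    have h2 : t ^ 2 * Q + ∫ x, (-t * φ x) * f (-t * φ x) = 0 := ht
    rw [h2, mul_zero] at h1
    exact h1
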